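/- arXiv:2201.05342 — 3 statements merged into one kernel-verified Lean document; each statement's English description precedes it below -/
import Mathlib

section
/- With the notation and hypotheses of the previous statement (P symmetric solving P = Q + AᵀPA − AᵀPB(R+BᵀPB)⁻¹BᵀPA, R + BᵀPB positive definite, K = (R+BᵀPB)⁻¹BᵀPA, x(s+1) = A x(s) + B u(s)), for every k ≤ T one has Σ_{s=k}^{T} [x(s)ᵀQx(s) + u(s)ᵀRu(s)] ≥ x(k)ᵀP x(k) − x(T+1)ᵀP x(T+1), with equality if and only if u(s) = −K x(s) for all s with k ≤ s ≤ T. -/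
open Matrix Finset

/-- One-step completion of squares. -/
theorem step_identity
    {n m : ℕ}
    (A : Matrix (Fin n) (Fin n) ℝ) (B : Matrix (Fin n) (Fin m) ℝ)
    (Q P : Matrix (Fin n) (Fin n) ℝ) (R : Matrix (Fin m) (Fin m) ℝ)
    (hP : P.IsSymm) (hR : R.IsSymm)
    (hpos : (R + Bᵀ * P * B).PosDef)
    (hRic : P = Q + Aᵀ * P * A
      - Aᵀ * P * B * (R + Bᵀ * P * B)⁻¹ * (Bᵀ * P * A))
    (K : Matrix (Fin m) (Fin n) ℝ)
    (hK : K = (R + Bᵀ * P * B)⁻¹ * (Bᵀ * P * A))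
    (u : Fin m → ℝ) (x : Fin n → ℝ) :
    x ⬝ᵥ (Q *ᵥ x) + u ⬝ᵥ (R *ᵥ u) =
      x ⬝ᵥ (P *ᵥ x) - (A *ᵥ x + B *ᵥ u) ⬝ᵥ (P *ᵥ (A *ᵥ x + B *ᵥ u))
        + (u + K *ᵥ x) ⬝ᵥ ((R + Bᵀ * P * B) *ᵥ (u + K *ᵥ x)) := by
  have hSK : (R + Bᵀ * P * B) * K = Bᵀ * P * A := by
    rw [hK, Matrix.mul_nonsing_inv_cancel_left]
    exact (Matrix.isUnit_iff_isUnit_det _).1 hpos.isUnit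
  have hRic' : P = Q + Aᵀ * P * A - Aᵀ * P * B * K := by
    rw [hK, ← Matrix.mul_assoc]
    exact hRic
  have symm : ∀ {l : ℕ} (M : Matrix (Fin l) (Fin l) ℝ), M.IsSymm →
      ∀ v w : Fin l → ℝ, v ⬝ᵥ (M *ᵥ w) = w ⬝ᵥ (M *ᵥ v) := by
    intro l M hM v w
    rw [dotProduct_mulVec, ← mulVec_transpose, hM.eq, dotProduct_comm]
  have tr : ∀ {k l : ℕ} (M : Matrix (Fin k) (Fin l) ℝ) (v : Fin l → ℝ) (w : Fin k → ℝ),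
      v ⬝ᵥ (Mᵀ *ᵥ w) = (M *ᵥ v) ⬝ᵥ w := by
    intro k l M v w
    rw [dotProduct_mulVec, vecMul_transpose]
  have h1 : x ⬝ᵥ (P *ᵥ x) = x ⬝ᵥ (Q *ᵥ x) + (A *ᵥ x) ⬝ᵥ (P *ᵥ (A *ᵥ x))
      - (A *ᵥ x) ⬝ᵥ (P *ᵥ (B *ᵥ (K *ᵥ x))) := by
    conv_lhs => rw [hRic']
    simp only [sub_mulVec, add_mulVec, dotProduct_sub, dotProduct_add, ← mulVec_mulVec, tr]
  have hS : ∀ v : Fin m → ℝ, v ⬝ᵥ ((R + Bᵀ * P * B) *ᵥ (K *ᵥ x))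
      = (B *ᵥ v) ⬝ᵥ (P *ᵥ (A *ᵥ x)) := by
    intro v
    rw [mulVec_mulVec, hSK]
    simp only [← mulVec_mulVec, tr]
  have hSu : u ⬝ᵥ ((R + Bᵀ * P * B) *ᵥ u)
      = u ⬝ᵥ (R *ᵥ u) + (B *ᵥ u) ⬝ᵥ (P *ᵥ (B *ᵥ u)) := by
    simp only [add_mulVec, dotProduct_add, ← mulVec_mulVec, tr]
  have hSsymm : (R + Bᵀ * P * B).IsSymm := by
    unfold Matrix.IsSymm
    simp only [transpose_add, transpose_mul, transpose_transpose, hP.eq, hR.eq, Matrix.mul_assoc]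
  have h2 := symm _ hSsymm (K *ᵥ x) u
  have h3 := symm P hP (A *ᵥ x) (B *ᵥ u)
  have h4 := symm P hP (A *ᵥ x) (B *ᵥ (K *ᵥ x))
  have h5 := hS u
  have h6 := hS (K *ᵥ x)
  rw [mulVec_add (R + Bᵀ * P * B), mulVec_add P]
  simp only [dotProduct_add, add_dotProduct]
  linarith

/-- Finite-horizon optimality of the Riccati feedback: the accumulated cost
dominates the difference of the quadratic forms of `P`, with equality iff
`u(s) = -K x(s)` on the horizon. -/
theorem finite_horizon_optimality
    {n m : ℕ}
    (A : Matrix (Fin n) (Fin n) ℝ) (B : Matrix (Fin n) (Fin m) ℝ)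
    (Q P : Matrix (Fin n) (Fin n) ℝ) (R : Matrix (Fin m) (Fin m) ℝ)
    (hP : P.IsSymm) (hQ : Q.IsSymm) (hR : R.IsSymm)
    (hpos : (R + Bᵀ * P * B).PosDef)
    (hRic : P = Q + Aᵀ * P * A
      - Aᵀ * P * B * (R + Bᵀ * P * B)⁻¹ * (Bᵀ * P * A))
    (K : Matrix (Fin m) (Fin n) ℝ)
    (hK : K = (R + Bᵀ * P * B)⁻¹ * (Bᵀ * P * A))
    (u : ℕ → Fin m → ℝ) (x : ℕ → Fin n → ℝ)
    (hx : ∀ s, x (s + 1) = A *ᵥ x s + B *ᵥ u s) :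
    ∀ k T : ℕ, k ≤ T →
      ((∑ s ∈ Finset.Icc k T, (x s ⬝ᵥ (Q *ᵥ x s) + u s ⬝ᵥ (R *ᵥ u s)))
          ≥ x k ⬝ᵥ (P *ᵥ x k) - x (T + 1) ⬝ᵥ (P *ᵥ x (T + 1)))
      ∧ ((∑ s ∈ Finset.Icc k T, (x s ⬝ᵥ (Q *ᵥ x s) + u s ⬝ᵥ (R *ᵥ u s)))
          = x k ⬝ᵥ (P *ᵥ x k) - x (T + 1) ⬝ᵥ (P *ᵥ x (T + 1))
        ↔ ∀ s, k ≤ s → s ≤ T → u s = -(K *ᵥ x s)) := by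
  have key : ∀ s, x s ⬝ᵥ (Q *ᵥ x s) + u s ⬝ᵥ (R *ᵥ u s) =
      x s ⬝ᵥ (P *ᵥ x s) - x (s + 1) ⬝ᵥ (P *ᵥ x (s + 1))
        + (u s + K *ᵥ x s) ⬝ᵥ ((R + Bᵀ * P * B) *ᵥ (u s + K *ᵥ x s)) := by
    intro s
    rw [hx s]
    exact step_identity A B Q P R hP hR hpos hRic K hK (u s) (x s)
  have hnn : ∀ v : Fin m → ℝ, 0 ≤ v ⬝ᵥ ((R + Bᵀ * P * B) *ᵥ v) := by
    intro v
    simpa using hpos.posSemidef.dotProduct_mulVec_nonneg v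
  have hz : ∀ v : Fin m → ℝ, v ⬝ᵥ ((R + Bᵀ * P * B) *ᵥ v) = 0 ↔ v = 0 := by
    intro v
    constructor
    · intro h
      by_contra hv
      have := hpos.dotProduct_mulVec_pos hv
      simp only [star_trivial] at this
      linarith
    · rintro rfl
      simp
  intro k T hkT
  have tele : (∑ s ∈ Finset.Icc k T, (x s ⬝ᵥ (Q *ᵥ x s) + u s ⬝ᵥ (R *ᵥ u s)))
      = x k ⬝ᵥ (P *ᵥ x k) - x (T + 1) ⬝ᵥ (P *ᵥ x (T + 1))
        + ∑ s ∈ Finset.Icc k T,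
          (u s + K *ᵥ x s) ⬝ᵥ ((R + Bᵀ * P * B) *ᵥ (u s + K *ᵥ x s)) := by
    induction T, hkT using Nat.le_induction with
    | base => simpa using key k
    | succ T hT ih =>
      rw [Finset.sum_Icc_succ_top (by omega), Finset.sum_Icc_succ_top (by omega), ih, key (T + 1)]
      ring
  have hsum := Finset.sum_nonneg (s := Finset.Icc k T)
    (fun s _ => hnn (u s + K *ᵥ x s))
  refine ⟨by rw [tele]; linarith, ?_⟩
  rw [tele, add_eq_left, Finset.sum_eq_zero_iff_of_nonneg (fun s _ => hnn (u s + K *ᵥ x s))]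
  simp only [hz, Finset.mem_Icc, and_imp, add_eq_zero_iff_eq_neg]
end

section
/- Let G = [[G_xx, G_xu],[G_xuᵀ, G_uu]] be a symmetric real block matrix (G_xx of size n×n, G_uu of size m×m) with G_uu invertible, and define Π(G) = G_xx − G_xu G_uu⁻¹ G_xuᵀ. Let T = [[T₁, 0],[E, T₂]] be a block matrix with T₁ ∈ ℝ^{n×n} arbitrary, E ∈ ℝ^{m×n} arbitrary, and T₂ ∈ ℝ^{m×m} invertible. Then the (uu)-block of TᵀGT is invertible and Π(TᵀGT) = T₁ᵀ Π(G) T₁. -/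
open Matrix

/-- The Schur complement map `Π(G) = G_xx − G_xu G_uu⁻¹ G_xuᵀ`. -/
noncomputable def schurPi {n m : ℕ}
    (G : Matrix (Fin n ⊕ Fin m) (Fin n ⊕ Fin m) ℝ) : Matrix (Fin n) (Fin n) ℝ :=
  G.toBlocks₁₁ - G.toBlocks₁₂ * (G.toBlocks₂₂)⁻¹ * (G.toBlocks₁₂)ᵀ

/-- Congruence invariance of the Schur complement `Π` under block
lower-triangular transformations: `Π(TᵀGT) = T₁ᵀ Π(G) T₁`. -/
theorem schurPi_congruence
    {n m : ℕ}
    (G : Matrix (Fin n ⊕ Fin m) (Fin n ⊕ Fin m) ℝ)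
    (hG : G.IsSymm) (hGuu : IsUnit G.toBlocks₂₂)
    (T₁ : Matrix (Fin n) (Fin n) ℝ) (E : Matrix (Fin m) (Fin n) ℝ)
    (T₂ : Matrix (Fin m) (Fin m) ℝ) (hT₂ : IsUnit T₂)
    (T : Matrix (Fin n ⊕ Fin m) (Fin n ⊕ Fin m) ℝ)
    (hT : T = Matrix.fromBlocks T₁ 0 E T₂) :
    IsUnit (Tᵀ * G * T).toBlocks₂₂
      ∧ schurPi (Tᵀ * G * T) = T₁ᵀ * schurPi G * T₁ := by
  obtain ⟨A, B, C, D, rfl⟩ : ∃ A B C D, G = Matrix.fromBlocks A B C D :=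
    ⟨_, _, _, _, (Matrix.fromBlocks_toBlocks G).symm⟩
  rw [Matrix.isSymm_fromBlocks_iff] at hG
  obtain ⟨hA, hB, hC, hD⟩ := hG
  subst hB
  rw [Matrix.toBlocks_fromBlocks₂₂] at hGuu
  have hdD : IsUnit D.det := (Matrix.isUnit_iff_isUnit_det D).1 hGuu
  have hdT : IsUnit T₂.det := (Matrix.isUnit_iff_isUnit_det T₂).1 hT₂
  have hdTt : IsUnit T₂ᵀ.det := by rwa [Matrix.det_transpose]
  have hTt : IsUnit T₂ᵀ := (Matrix.isUnit_iff_isUnit_det _).2 hdTt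
  have hM : Tᵀ * Matrix.fromBlocks A B Bᵀ D * T =
      Matrix.fromBlocks ((T₁ᵀ * A + Eᵀ * Bᵀ) * T₁ + (T₁ᵀ * B + Eᵀ * D) * E)
        ((T₁ᵀ * B + Eᵀ * D) * T₂)
        (T₂ᵀ * Bᵀ * T₁ + T₂ᵀ * D * E) (T₂ᵀ * D * T₂) := by
    rw [hT, Matrix.fromBlocks_transpose, Matrix.fromBlocks_multiply,
      Matrix.fromBlocks_multiply]
    simp
  rw [hM]
  refine ⟨?_, ?_⟩
  · rw [Matrix.toBlocks_fromBlocks₂₂]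
    exact (hTt.mul hGuu).mul hT₂
  · unfold schurPi
    simp only [Matrix.toBlocks_fromBlocks₁₁, Matrix.toBlocks_fromBlocks₁₂,
      Matrix.toBlocks_fromBlocks₂₂]
    have key : ∀ W : Matrix (Fin n) (Fin m) ℝ,
        W * T₂ * (T₂ᵀ * D * T₂)⁻¹ * (W * T₂)ᵀ = W * D⁻¹ * Wᵀ := by
      intro W
      rw [Matrix.mul_inv_rev, Matrix.mul_inv_rev, Matrix.transpose_mul]
      simp only [Matrix.mul_assoc]
      rw [Matrix.nonsing_inv_mul_cancel_left _ _ hdTt,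
        Matrix.mul_nonsing_inv_cancel_left _ _ hdT]
    rw [key]
    have hW : (T₁ᵀ * B + Eᵀ * D)ᵀ = Bᵀ * T₁ + D * E := by
      rw [Matrix.transpose_add, Matrix.transpose_mul, Matrix.transpose_mul,
        Matrix.transpose_transpose, Matrix.transpose_transpose, hD]
    rw [hW]
    simp only [Matrix.add_mul, Matrix.mul_add, Matrix.sub_mul, Matrix.mul_sub, Matrix.mul_assoc,
      Matrix.nonsing_inv_mul_cancel_left _ _ hdD, Matrix.mul_nonsing_inv_cancel_left _ _ hdD]
    abel
end

section
/- Let E be a real normed vector space and S : E → E a continuous linear map for which there exist c > 0 and ρ ∈ (0,1) with ‖S^k‖ ≤ c ρ^k for all k ∈ ℕ. Let α : ℕ → ℝ with α(k) ≥ 0 and α(k) → 0, and let φ : ℕ → E be bounded (there is C with ‖φ(k)‖ ≤ C for all k). If δ : ℕ → E satisfies δ(k+1) = S(δ(k)) + α(k)φ(k), then ‖δ(k)‖ → 0 as k → ∞. -/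
open Filter

/-- Deterministic core of the consensus theorem: if `‖S^k‖ ≤ c ρ^k` with
`ρ ∈ (0,1)`, the learning rates vanish and the drive is bounded, then the
solution of `δ(k+1) = S δ(k) + α(k) φ(k)` tends to zero in norm. -/
theorem disagreement_tendsto_zero
    {E : Type*} [NormedAddCommGroup E] [NormedSpace ℝ E]
    (S : E →L[ℝ] E)
    (c : ℝ) (hc : 0 < c) (ρ : ℝ) (hρ : ρ ∈ Set.Ioo (0 : ℝ) 1)
    (hS : ∀ k : ℕ, ‖S ^ k‖ ≤ c * ρ ^ k)
    (α : ℕ → ℝ) (hα : ∀ k, 0 ≤ α k) (hα0 : Tendsto α atTop (nhds 0))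
    (φ : ℕ → E) (C : ℝ) (hφ : ∀ k, ‖φ k‖ ≤ C)
    (δ : ℕ → E) (hδ : ∀ k, δ (k + 1) = S (δ k) + α k • φ k) :
    Tendsto (fun k => ‖δ k‖) atTop (nhds 0) := by
  obtain ⟨hρ0, hρ1⟩ := hρ
  have h1 : 0 < 1 - ρ := by linarith
  have hC : 0 ≤ C := (norm_nonneg _).trans (hφ 0)
  obtain ⟨K, hK⟩ : ∃ K : ℝ, K = c * C / (1 - ρ) := ⟨_, rfl⟩
  have hK0 : 0 ≤ K := by rw [hK]; positivity
  have hK1 : K * ρ + c * C = K := by rw [hK]; field_simp; ring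
  -- variation-of-constants bound started at time `m`
  have key : ∀ (a : ℝ) (m : ℕ), (∀ k, m ≤ k → α k ≤ a) → ∀ n j : ℕ,
      ‖(S ^ j) (δ (m + n))‖ ≤ c * ρ ^ (n + j) * ‖δ m‖ + a * K * ρ ^ j := by
    intro a m ha n
    have ha0 : 0 ≤ a := (hα m).trans (ha m le_rfl)
    induction n with
    | zero =>
      intro j
      have h2 : ‖(S ^ j) (δ m)‖ ≤ c * ρ ^ j * ‖δ m‖ :=
        ((S ^ j).le_opNorm _).trans (mul_le_mul_of_nonneg_right (hS j) (norm_nonneg _))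
      have h3 : 0 ≤ a * K * ρ ^ j := by positivity
      simpa using h2.trans (le_add_of_nonneg_right h3)
    | succ n ih =>
      intro j
      have e : (S ^ j) (δ (m + (n + 1)))
          = (S ^ (j + 1)) (δ (m + n)) + α (m + n) • (S ^ j) (φ (m + n)) := by
        rw [← add_assoc, hδ, map_add, map_smul, pow_succ]
        rfl
      have h2 : ‖(S ^ j) (φ (m + n))‖ ≤ c * ρ ^ j * C :=
        ((S ^ j).le_opNorm _).trans
          (mul_le_mul (hS j) (hφ _) (norm_nonneg _) (by positivity))
      have h3 : ‖α (m + n) • (S ^ j) (φ (m + n))‖ ≤ a * (c * ρ ^ j * C) := by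
        rw [norm_smul, Real.norm_of_nonneg (hα _)]
        exact mul_le_mul (ha _ (by omega)) h2 (norm_nonneg _) ha0
      rw [e]
      refine ((norm_add_le _ _).trans (add_le_add (ih (j + 1)) h3)).trans (le_of_eq ?_)
      have h4 : a * K * ρ ^ j = a * (K * ρ + c * C) * ρ ^ j := by rw [hK1]
      rw [h4]
      ring
  rw [Metric.tendsto_atTop]
  intro ε hε
  have hapos : 0 < ε / (2 * (K + 1)) := by positivity
  obtain ⟨m, hm⟩ := eventually_atTop.1 (hα0.eventually (ge_mem_nhds hapos))
  have hb := key _ m hm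
  have haK : ε / (2 * (K + 1)) * K < ε / 2 := by
    rw [div_mul_eq_mul_div, div_lt_div_iff₀ (by positivity) (by norm_num)]
    nlinarith
  have ht : Tendsto (fun n : ℕ => c * ρ ^ n * ‖δ m‖) atTop (nhds 0) := by
    simpa using ((tendsto_pow_atTop_nhds_zero_of_lt_one hρ0.le hρ1).const_mul c).mul_const ‖δ m‖
  obtain ⟨N, hN⟩ := eventually_atTop.1 (ht.eventually (gt_mem_nhds (half_pos hε)))
  refine ⟨m + N, fun n hn => ?_⟩
  obtain ⟨p, rfl⟩ := Nat.exists_eq_add_of_le ((Nat.le_add_right m N).trans hn)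
  have h5 := hb p 0
  have h6 := hN p (by omega)
  simp only [pow_zero, add_zero, mul_one, ContinuousLinearMap.one_apply] at h5
  rw [dist_zero_right, norm_norm]
  linarith
end
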